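/- Let x, y, z be positive pairwise coprime integers. Then the trinomial surface V(T_0^x + T_1^y + T_2^z) ⊆ ℂ³ has trivial divisor class group, i.e., its coordinate ring ℂ[T_0, T_1, T_2]/⟨T_0^x + T_1^y + T_2^z⟩ is a unique factorization domain. -/

import Mathlib

open MvPolynomial

theorem nagata_three {R T : Type*} [CommRing R] [IsDomain R] [WfDvdMonoid R] [CommRing T]
    [Algebra R T] (a b c : R) (ha : Prime a) (hb : Prime b) (hc : Prime c)
    [IsLocalization.Away (a * b * c) T] [UniqueFactorizationMonoid T] :
    UniqueFactorizationMonoid R := by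
  have hne : a * b * c ≠ 0 := mul_ne_zero (mul_ne_zero ha.ne_zero hb.ne_zero) hc.ne_zero
  have hT : IsDomain T := IsLocalization.Away.isDomain T hne
  have hinj : Function.Injective (algebraMap R T) :=
    IsLocalization.injective T (powers_le_nonZeroDivisors_of_noZeroDivisors hne)
  rw [UniqueFactorizationMonoid.iff_exists_prime_mem_of_isPrime]
  intro p hp0 hp
  by_cases hap : a ∈ p
  · exact ⟨a, hap, ha⟩
  by_cases hbp : b ∈ p
  · exact ⟨b, hbp, hb⟩
  by_cases hcp : c ∈ p
  · exact ⟨c, hcp, hc⟩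
  have habc : a * b * c ∉ p := by
    intro h
    rcases hp.mem_or_mem h with h | h
    · rcases hp.mem_or_mem h with h | h
      · exact hap h
      · exact hbp h
    · exact hcp h
  have hd := (Ideal.disjoint_powers_iff_notMem_of_isPrime (I := p) (a * b * c)).mpr habc
  have hpT := IsLocalization.isPrime_of_isPrime_disjoint (Submonoid.powers (a * b * c)) T p hp hd
  have hpT0 : p.map (algebraMap R T) ≠ ⊥ := by
    simp [Ideal.map_eq_bot_iff_of_injective hinj, hp0]
  have hu : IsUnit (algebraMap R T (a * b * c)) := IsLocalization.Away.algebraMap_isUnit _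
  obtain ⟨π, hπ, hπp⟩ := hpT.exists_mem_prime_of_ne_bot hpT0
  have hex : ∃ g : R, g ∈ p ∧ Prime (algebraMap R T g) := by
    obtain ⟨⟨i, m⟩, h⟩ := (IsLocalization.mem_map_algebraMap_iff
      (Submonoid.powers (a * b * c)) T).1 hπ
    refine ⟨i, i.2, ?_⟩
    have h' : π * algebraMap R T m = algebraMap R T i := h
    rw [← h']
    have : IsUnit (algebraMap R T m) := IsLocalization.map_units T m
    exact (associated_mul_unit_right π _ this).prime hπp
  obtain ⟨g, ⟨hgp, hgP⟩, hmin⟩ := (IsWellFounded.wf : WellFounded (DvdNotUnit : R → R → Prop)).has_min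
    {g | g ∈ p ∧ Prime (algebraMap R T g)} hex
  have hg0 : g ≠ 0 := by rintro rfl; simp at hgP
  have strip : ∀ q : R, Prime q → q ∉ p → q ∣ a * b * c → ¬ q ∣ g := by
    rintro q hq hqp hqd ⟨g', rfl⟩
    have hg'p : g' ∈ p := (hp.mem_or_mem hgp).resolve_left hqp
    have hqu : IsUnit (algebraMap R T q) :=
      isUnit_of_dvd_unit (map_dvd (algebraMap R T) hqd) hu
    refine hmin g' ⟨hg'p, ?_⟩ ⟨right_ne_zero_of_mul hg0, q, hq.not_isUnit, mul_comm _ _⟩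
    rw [map_mul] at hgP
    exact (associated_unit_mul_left _ _ hqu).prime hgP
  have hag := strip a ha hap ⟨b * c, by ring⟩
  have hbg := strip b hb hbp ⟨a * c, by ring⟩
  have hcg := strip c hc hcp ⟨a * b, by ring⟩
  have cancel : ∀ (n : ℕ) (r : R), g ∣ (a * b * c) ^ n * r → g ∣ r := by
    intro n
    induction n with
    | zero => intro r h; simpa using h
    | succ n ih =>
      intro r h
      apply ih
      have h1 : g ∣ a * (b * (c * ((a * b * c) ^ n * r))) := by
        convert h using 1; ring
      have h2 := (ha.left_dvd_or_dvd_right_of_dvd_mul h1).resolve_left hag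
      have h3 := (hb.left_dvd_or_dvd_right_of_dvd_mul h2).resolve_left hbg
      exact (hc.left_dvd_or_dvd_right_of_dvd_mul h3).resolve_left hcg
  have back : ∀ r : R, algebraMap R T g ∣ algebraMap R T r → g ∣ r := by
    rintro r ⟨t, ht⟩
    obtain ⟨n, s, hs⟩ := IsLocalization.Away.surj (a * b * c) t
    apply cancel n
    refine ⟨s, hinj ?_⟩
    rw [map_mul, map_mul, map_pow, ht, ← hs]; ring
  refine ⟨g, hgp, hg0, fun h => hgP.not_isUnit (h.map _), ?_⟩
  intro u v huv
  have := map_dvd (algebraMap R T) huv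
  rw [map_mul] at this
  exact (hgP.dvd_or_dvd this).imp (back u) (back v)

theorem prime_of_param {R : Type*} [CommRing R] [Algebra ℂ R] (a b c : R) (y z : ℕ)
    (hz : 0 < z) (hyz : Nat.Coprime y z)
    (hgen : Algebra.adjoin ℂ {a, b, c} = ⊤) (hrel : a ∣ b ^ y + c ^ z)
    (χ : R →ₐ[ℂ] Polynomial ℂ) (ζ : ℂ) (hζ : ζ ≠ 0)
    (hχa : χ a = 0) (hχb : χ b = Polynomial.X ^ z)
    (hχc : χ c = Polynomial.C ζ * Polynomial.X ^ y) (ha0 : a ≠ 0) : Prime a := by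
  let M : (ℕ × Fin z →₀ ℂ) →ₗ[ℂ] R :=
    Finsupp.linearCombination ℂ (fun mk : ℕ × Fin z => b ^ mk.1 * c ^ (mk.2 : ℕ))
  let W : Submodule ℂ R := (Ideal.span {a}).restrictScalars ℂ ⊔ LinearMap.range M
  have haW : ∀ r, a ∣ r → r ∈ W := fun r hr =>
    Submodule.mem_sup_left (by simpa [Ideal.mem_span_singleton] using hr)
  have hmon : ∀ n i : ℕ, b ^ i * c ^ n ∈ W := by
    intro n
    induction n using Nat.strong_induction_on with
    | _ n ih =>
      intro i
      by_cases h : n < z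
      · refine Submodule.mem_sup_right ⟨Finsupp.single (i, ⟨n, h⟩) 1, ?_⟩
        simp [M]
      · obtain ⟨k, rfl⟩ := Nat.exists_eq_add_of_le (not_lt.1 h)
        have : b ^ i * c ^ (z + k) = b ^ i * c ^ k * (b ^ y + c ^ z) - b ^ (i + y) * c ^ k := by
          ring
        rw [this]
        exact W.sub_mem (haW _ (hrel.mul_left _)) (ih k (by omega) _)
  have hcl : ∀ m ∈ Submonoid.closure {a, b, c}, (∃ i j : ℕ, m = b ^ i * c ^ j) ∨ a ∣ m := by
    intro m hm
    induction hm using Submonoid.closure_induction with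
    | mem m hm =>
      rcases hm with rfl | rfl | rfl
      · exact Or.inr dvd_rfl
      · exact Or.inl ⟨1, 0, by simp⟩
      · exact Or.inl ⟨0, 1, by simp⟩
    | one => exact Or.inl ⟨0, 0, by simp⟩
    | mul m n _ _ h1 h2 =>
      rcases h1 with ⟨i, j, rfl⟩ | h1
      · rcases h2 with ⟨k, l, rfl⟩ | h2
        · exact Or.inl ⟨i + k, j + l, by ring⟩
        · exact Or.inr (h2.mul_left _)
      · exact Or.inr (h1.mul_right _)
  have hW : ∀ r, r ∈ W := by
    intro r
    have hr : r ∈ Submodule.span ℂ ((Submonoid.closure {a, b, c} : Submonoid R) : Set R) := by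
      rw [← Algebra.adjoin_eq_span, hgen]; trivial
    refine (Submodule.span_le.2 ?_) hr
    intro m hm
    rcases hcl m hm with ⟨i, j, rfl⟩ | h
    · exact hmon _ _
    · exact haW _ h
  have hinj : Function.Injective (fun mk : ℕ × Fin z => z * mk.1 + y * (mk.2 : ℕ)) := by
    rintro ⟨m, k⟩ ⟨m', k'⟩ h
    have h' : z * m + y * k = z * m' + y * k' := h
    have hk : (k : ℕ) = k' := by
      have h1 : y * k ≡ y * k' [MOD z] := by
        have : z * m + y * k ≡ z * m' + y * k' [MOD z] := by rw [h']
        simpa [Nat.ModEq, Nat.add_mod] using this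
      have h2 := Nat.ModEq.cancel_left_of_coprime (by simpa using hyz.symm) h1
      exact Nat.ModEq.eq_of_lt_of_lt h2 k.2 k'.2
    have hm : m = m' := by
      rw [hk] at h'
      exact Nat.eq_of_mul_eq_mul_left hz (Nat.add_right_cancel h')
    exact Prod.ext hm (Fin.ext hk)
  have hli : LinearIndependent ℂ (fun mk : ℕ × Fin z => χ (b ^ mk.1 * c ^ (mk.2 : ℕ))) := by
    have h1 := (Polynomial.basisMonomials ℂ).linearIndependent.comp _ hinj
    have h2 := h1.units_smul (fun mk => (Units.mk0 ζ hζ) ^ (mk.2 : ℕ))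
    convert h2 using 1
    funext mk
    simp only [map_mul, map_pow, hχb, hχc, Pi.smul_apply', Function.comp,
      Polynomial.coe_basisMonomials, Units.smul_def, Units.val_pow_eq_pow_val, Units.val_mk0,
      Polynomial.smul_eq_C_mul, ← Polynomial.X_pow_eq_monomial]
    simp only [mul_pow, ← pow_mul, pow_add]
    ring
  have hker : RingHom.ker χ = Ideal.span {a} := by
    apply le_antisymm
    · intro r hr
      obtain ⟨w, hw, m, ⟨v, rfl⟩, rfl⟩ := Submodule.mem_sup.1 (hW r)
      have hw' : a ∣ w := by simpa [Ideal.mem_span_singleton] using hw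
      have hχw : χ w = 0 := by
        obtain ⟨t, rfl⟩ := hw'; simp [hχa]
      have h0 : χ (M v) = 0 := by
        have : χ (w + M v) = 0 := hr
        simpa [hχw] using this
      have hv : v = 0 := by
        apply (linearIndependent_iff.1 hli) v
        rw [← h0]
        have := Finsupp.apply_linearCombination ℂ χ.toLinearMap
          (fun mk : ℕ × Fin z => b ^ mk.1 * c ^ (mk.2 : ℕ)) v
        exact this.symm
      rw [hv, map_zero, add_zero]
      exact Ideal.mem_span_singleton.2 hw'
    · rw [Ideal.span_singleton_le_iff_mem]; exact hχa
  have hP : (RingHom.ker χ).IsPrime := RingHom.ker_isPrime χ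
  rw [hker] at hP
  exact (Ideal.span_singleton_prime ha0).1 hP

theorem crt_exists (x m : ℕ) (hx : 0 < x) (h : Nat.Coprime x m) :
    ∃ k p : ℕ, x * k = m * p + 1 := by
  obtain ⟨n, h1, h2⟩ := Nat.chineseRemainder h (x - 1) 0
  obtain ⟨p, rfl⟩ := (Nat.modEq_zero_iff_dvd).1 h2
  have : m * p + 1 ≡ 0 [MOD x] := by
    have := h1.add_right 1
    rw [Nat.sub_add_cancel hx] at this
    exact this.trans (by simp [Nat.ModEq])
  obtain ⟨k, hk⟩ := (Nat.modEq_zero_iff_dvd).1 this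
  exact ⟨k, p, hk.symm⟩

theorem bezout_three (x y z : ℕ) 
    (hxy : Nat.Coprime x y) (hxz : Nat.Coprime x z) (hyz : Nat.Coprime y z) :
    ∃ i j k : ℤ, y * z * i + x * z * j + x * y * k = 1 := by
  obtain ⟨u, v, h⟩ := (Nat.isCoprime_iff_coprime.2 (hxy.mul_right hxz))
  obtain ⟨s, t, h'⟩ := (Nat.isCoprime_iff_coprime.2 hyz)
  push_cast at h
  refine ⟨v, u * t, u * s, ?_⟩
  linear_combination h + u * x * h'

/-- from the coordinates to `u` -/
theorem grp_aux {G : Type*} [CommGroup G] (x y z : ℕ) (i j k : ℤ)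
    (h : (y * z * i + x * z * j + x * y * k : ℤ) = 1) (a b c : G) (hab : a ^ x = b ^ y)
    (hbc : b ^ y = c ^ z) :
    (a ^ i * b ^ j * c ^ k) ^ (y * z) = a ∧ (a ^ i * b ^ j * c ^ k) ^ (x * z) = b ∧
      (a ^ i * b ^ j * c ^ k) ^ (x * y) = c := by
  have hab' : a ^ (x : ℤ) = b ^ (y : ℤ) := by exact_mod_cast hab
  have hbc' : b ^ (y : ℤ) = c ^ (z : ℤ) := by exact_mod_cast hbc
  simp only [← zpow_natCast (G := G), mul_zpow, ← zpow_mul]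
  push_cast
  refine ⟨?_, ?_, ?_⟩
  · have h1 : b ^ (j * (y * z : ℤ)) = a ^ (x * z * j : ℤ) := by
      rw [show (j * (y * z) : ℤ) = y * (z * j) by ring, zpow_mul, ← hab', ← zpow_mul]
      congr 1; ring
    have h2 : c ^ (k * (y * z : ℤ)) = a ^ (x * y * k : ℤ) := by
      rw [show (k * (y * z) : ℤ) = z * (y * k) by ring, zpow_mul, ← hbc', ← hab', ← zpow_mul]
      congr 1; ring
    rw [h1, h2, ← zpow_add, ← zpow_add]
    conv_rhs => rw [← zpow_one a, ← h]
    congr 1; ring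
  · have h1 : a ^ (i * (x * z : ℤ)) = b ^ (y * z * i : ℤ) := by
      rw [show (i * (x * z) : ℤ) = x * (z * i) by ring, zpow_mul, hab', ← zpow_mul]
      congr 1; ring
    have h2 : c ^ (k * (x * z : ℤ)) = b ^ (x * y * k : ℤ) := by
      rw [show (k * (x * z) : ℤ) = z * (x * k) by ring, zpow_mul, ← hbc', ← zpow_mul]
      congr 1; ring
    rw [h1, h2, ← zpow_add, ← zpow_add]
    conv_rhs => rw [← zpow_one b, ← h]
    congr 1; ring
  · have h1 : a ^ (i * (x * y : ℤ)) = c ^ (y * z * i : ℤ) := by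
      rw [show (i * (x * y) : ℤ) = x * (y * i) by ring, zpow_mul, hab', hbc', ← zpow_mul]
      congr 1; ring
    have h2 : b ^ (j * (x * y : ℤ)) = c ^ (x * z * j : ℤ) := by
      rw [show (j * (x * y) : ℤ) = y * (x * j) by ring, zpow_mul, hbc', ← zpow_mul]
      congr 1; ring
    rw [h1, h2, ← zpow_add, ← zpow_add]
    conv_rhs => rw [← zpow_one c, ← h]
    congr 1; ring

theorem grp_to {G : Type*} [CommGroup G] (x y z P p' Q q' : ℕ) (i j k : ℤ)
    (h : (y * z * i + x * z * j + x * y * k : ℤ) = 1)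
    (hP : x * P = y * z * p' + 1) (hQ : z * Q = x * y * q' + 1) (a b c s t u : G)
    (hs : s = a ^ x / b ^ y) (ht : t = c ^ z / b ^ y)
    (hu : u = (a / (s ^ P * t ^ (y * q'))) ^ i * (b / (s ^ (z * p') * t ^ (x * q'))) ^ j *
      (c / (s ^ (y * p') * t ^ Q)) ^ k) :
    s ^ P * t ^ (y * q') * u ^ (y * z) = a ∧ s ^ (z * p') * t ^ (x * q') * u ^ (x * z) = b ∧
      s ^ (y * p') * t ^ Q * u ^ (x * y) = c := by
  have hs' : a ^ x = s * b ^ y := by rw [hs]; simp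
  have ht' : c ^ z = t * b ^ y := by rw [ht]; simp
  have e1 : (s ^ P * t ^ (y * q')) ^ x = s * (s ^ (z * p') * t ^ (x * q')) ^ y := by
    simp only [mul_pow, ← pow_mul]
    rw [mul_comm P x, hP, pow_succ]
    rw [show y * q' * x = x * q' * y by ring, show y * z * p' = z * p' * y by ring]
    ac_rfl
  have e2 : (s ^ (y * p') * t ^ Q) ^ z = t * (s ^ (z * p') * t ^ (x * q')) ^ y := by
    simp only [mul_pow, ← pow_mul]
    rw [mul_comm Q z, hQ, pow_succ]
    rw [show y * p' * z = z * p' * y by ring, show x * y * q' = x * q' * y by ring]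
    ac_rfl
  have h1 : (a / (s ^ P * t ^ (y * q'))) ^ x = (b / (s ^ (z * p') * t ^ (x * q'))) ^ y := by
    rw [div_pow, div_pow, hs', e1, mul_div_mul_left_eq_div]
  have h2 : (b / (s ^ (z * p') * t ^ (x * q'))) ^ y = (c / (s ^ (y * p') * t ^ Q)) ^ z := by
    rw [div_pow, div_pow, ht', e2, mul_div_mul_left_eq_div]
  obtain ⟨g1, g2, g3⟩ := grp_aux x y z i j k h _ _ _ h1 h2
  rw [← hu] at g1 g2 g3
  rw [g1, g2, g3]
  simp

theorem grp_from {G : Type*} [CommGroup G] (x y z P p' Q q' : ℕ) (i j k : ℤ)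
    (h : (y * z * i + x * z * j + x * y * k : ℤ) = 1)
    (hP : x * P = y * z * p' + 1) (hQ : z * Q = x * y * q' + 1) (a b c s t u : G)
    (ha : a = s ^ P * t ^ (y * q') * u ^ (y * z))
    (hb : b = s ^ (z * p') * t ^ (x * q') * u ^ (x * z))
    (hc : c = s ^ (y * p') * t ^ Q * u ^ (x * y)) :
    a ^ x = s * b ^ y ∧ c ^ z = t * b ^ y ∧
    (a / (s ^ P * t ^ (y * q'))) ^ i * (b / (s ^ (z * p') * t ^ (x * q'))) ^ j *
      (c / (s ^ (y * p') * t ^ Q)) ^ k = u := by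
  refine ⟨?_, ?_, ?_⟩
  · rw [ha, hb]
    simp only [mul_pow, ← pow_mul]
    rw [mul_comm P x, hP, pow_succ]
    rw [show y * q' * x = x * q' * y by ring, show y * z * p' = z * p' * y by ring,
      show y * z * x = x * z * y by ring]
    ac_rfl
  · rw [hc, hb]
    simp only [mul_pow, ← pow_mul]
    rw [mul_comm Q z, hQ, pow_succ]
    rw [show y * p' * z = z * p' * y by ring, show x * y * q' = x * q' * y by ring,
      show x * y * z = x * z * y by ring]
    ac_rfl
  · rw [ha, hb, hc]
    simp only [mul_div_cancel_left]
    simp only [← zpow_natCast (G := G), ← zpow_mul, ← zpow_add]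
    push_cast
    rw [h, zpow_one]

/-- The universal properties of the coordinate ring of the surface. -/
structure IsSurf (R : Type) [CommRing R] [Algebra ℂ R] (x y z : ℕ) (g : Fin 3 → R) : Prop where
  rel : g 0 ^ x + g 1 ^ y + g 2 ^ z = 0
  gen : Algebra.adjoin ℂ {g 0, g 1, g 2} = ⊤
  lift : ∀ (B : Type) [CommRing B] [Algebra ℂ B] (v : Fin 3 → B),
    v 0 ^ x + v 1 ^ y + v 2 ^ z = 0 → ∃ f : R →ₐ[ℂ] B, ∀ i, f (g i) = v i

theorem isSurf_quot (I : Ideal (MvPolynomial (Fin 3) ℂ)) (x y z : ℕ)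
    (hI : I = Ideal.span {(X 0 : MvPolynomial (Fin 3) ℂ) ^ x + X 1 ^ y + X 2 ^ z}) :
    IsSurf (MvPolynomial (Fin 3) ℂ ⧸ I) x y z (fun i => Ideal.Quotient.mkₐ ℂ I (X i)) where
  rel := by
    rw [← map_pow, ← map_pow, ← map_pow, ← map_add, ← map_add]
    refine Ideal.Quotient.eq_zero_iff_mem.2 ?_
    rw [hI]
    exact Ideal.mem_span_singleton_self _
  gen := by
    have h2 := congrArg (Subalgebra.map (Ideal.Quotient.mkₐ ℂ I))
      (MvPolynomial.adjoin_range_X (R := ℂ) (σ := Fin 3))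
    rw [AlgHom.map_adjoin, Algebra.map_top, (AlgHom.range_eq_top _).2
      (Ideal.Quotient.mkₐ_surjective ℂ _), ← Set.range_comp] at h2
    rw [← h2]
    congr 1
    ext r
    simp only [Set.mem_insert_iff, Set.mem_singleton_iff, Set.mem_range, Fin.exists_fin_succ,
      Function.comp]
    simp [eq_comm]
  lift := by
    intro B _ _ v hv
    refine ⟨Ideal.Quotient.liftₐ I (aeval v) ?_, ?_⟩
    · intro r hr
      rw [hI] at hr
      obtain ⟨t, rfl⟩ := Ideal.mem_span_singleton.1 hr
      simp [hv]
    · intro i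
      exact (Ideal.Quotient.liftₐ_apply _ _ _ _).trans (by
        simp only [Ideal.Quotient.mkₐ_eq_mk]
        exact aeval_X v i)

theorem exists_root (n : ℕ) (hn : 0 < n) : ∃ ζ : ℂ, ζ ^ n = -1 ∧ ζ ≠ 0 := by
  obtain ⟨ζ, h⟩ := IsAlgClosed.exists_pow_nat_eq (-1 : ℂ) hn
  refine ⟨ζ, h, ?_⟩
  rintro rfl
  rw [zero_pow hn.ne'] at h
  norm_num at h

theorem poly_rel (y z : ℕ) (ζ : ℂ) (h : ζ ^ z = -1) :
    ((Polynomial.X : Polynomial ℂ) ^ z) ^ y + (Polynomial.C ζ * Polynomial.X ^ y) ^ z = 0 := by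
  rw [mul_pow, ← Polynomial.C_pow, h, ← pow_mul, ← pow_mul, mul_comm y z]
  simp

theorem gen_prime {R : Type} [CommRing R] [Algebra ℂ R] {g : Fin 3 → R} (x y z : ℕ) (hx : 0 < x) (hy : 0 < y) (hz : 0 < z)
    (hxy : Nat.Coprime x y) (hxz : Nat.Coprime x z) (hyz : Nat.Coprime y z)
    (H : IsSurf R x y z g) (hne : ∀ i, g i ≠ 0) : ∀ i, Prime (g i) := by
  have hr := H.rel
  obtain ⟨ζ, hζ, hζ0⟩ := exists_root z hz
  obtain ⟨ξ, hξ, hξ0⟩ := exists_root y hy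
  have p0 : Prime (g 0) := by
    obtain ⟨χ, hχ⟩ := H.lift (Polynomial ℂ)
      ![0, Polynomial.X ^ z, Polynomial.C ζ * Polynomial.X ^ y] (by
        have := poly_rel y z ζ hζ
        simpa [hx.ne'] using this)
    refine prime_of_param (g 0) (g 1) (g 2) y z hz hyz
      (H.gen) ⟨- g 0 ^ (x - 1), ?_⟩ χ ζ hζ0 (hχ 0) (hχ 1) (hχ 2) (hne 0)
    rw [mul_neg, mul_pow_sub_one hx.ne']
    linear_combination hr
  have p1 : Prime (g 1) := by
    obtain ⟨χ, hχ⟩ := H.lift (Polynomial ℂ)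
      ![Polynomial.X ^ z, 0, Polynomial.C ζ * Polynomial.X ^ x] (by
        have := poly_rel x z ζ hζ
        simpa [hy.ne'] using this)
    refine prime_of_param (g 1) (g 0) (g 2) x z hz hxz
      (by rw [Set.insert_comm]; exact H.gen)
      ⟨- g 1 ^ (y - 1), ?_⟩ χ ζ hζ0 (hχ 1) (hχ 0) (hχ 2) (hne 1)
    rw [mul_neg, mul_pow_sub_one hy.ne']
    linear_combination hr
  have p2 : Prime (g 2) := by
    obtain ⟨χ, hχ⟩ := H.lift (Polynomial ℂ)
      ![Polynomial.X ^ y, Polynomial.C ξ * Polynomial.X ^ x, 0] (by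
        have := poly_rel x y ξ hξ
        simpa [hz.ne'] using this)
    refine prime_of_param (g 2) (g 0) (g 1) x y hy hxy
      (by rw [Set.insert_comm, Set.pair_comm (g 2)]; exact H.gen)
      ⟨- g 2 ^ (z - 1), ?_⟩ χ ξ hξ0 (hχ 2) (hχ 0) (hχ 1) (hne 2)
    rw [mul_neg, mul_pow_sub_one hz.ne']
    linear_combination hr
  intro i
  fin_cases i
  exacts [p0, p1, p2]

/-- the open part of the plane -/
noncomputable abbrev planeElt : MvPolynomial (Fin 2) ℂ := X 0 * (1 + X 0) * X 1

theorem planeElt_ne_zero : planeElt ≠ 0 := by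
  intro h
  have := congrArg (MvPolynomial.eval (fun _ => (1 : ℂ))) h
  simp at this

theorem away_units {A : Type*} {B : Type*} [CommRing A] [CommRing B] [Algebra A B] (a b c : A)
    [IsLocalization.Away (a * b * c) B] : ∃ u v w : Bˣ, (u : B) = algebraMap A B a ∧
      (v : B) = algebraMap A B b ∧ (w : B) = algebraMap A B c := by
  have hu : IsUnit (algebraMap A B (a * b * c)) := IsLocalization.Away.algebraMap_isUnit _
  rw [map_mul, map_mul, IsUnit.mul_iff, IsUnit.mul_iff] at hu
  obtain ⟨⟨⟨u, hu⟩, v, hv⟩, w, hw⟩ := hu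
  exact ⟨u, v, w, hu, hv, hw⟩

theorem away_lift {A B D : Type*} [CommRing A] [CommRing B] [CommRing D] [Algebra ℂ A]
    [Algebra ℂ B] [Algebra ℂ D] [Algebra A B] [IsScalarTower ℂ A B] (a : A)
    [IsLocalization.Away a B] (f : A →ₐ[ℂ] D) (h : IsUnit (f a)) :
    ∃ F : B →ₐ[ℂ] D, ∀ r, F (algebraMap A B r) = f r := by
  have hf : ∀ y : Submonoid.powers a, IsUnit (f y) := by
    rintro ⟨_, n, rfl⟩
    simpa using h.pow n
  exact ⟨IsLocalization.liftAlgHom (M := Submonoid.powers a) (S := B) hf, fun r => by simp⟩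

theorem surf_main {R : Type} [CommRing R] [Algebra ℂ R] {g : Fin 3 → R} (x y z : ℕ)
    (hx : 0 < x) (hz : 0 < z)
    (hxy : Nat.Coprime x y) (hxz : Nat.Coprime x z) (hyz : Nat.Coprime y z)
    (H : IsSurf R x y z g) (T S : Type) [CommRing T] [CommRing S] [Algebra ℂ T] [Algebra ℂ S]
    [Algebra R T] [IsScalarTower ℂ R T] [IsLocalization.Away (g 0 * g 1 * g 2) T]
    [Algebra (MvPolynomial (Fin 2) ℂ) S] [IsScalarTower ℂ (MvPolynomial (Fin 2) ℂ) S]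
    [IsLocalization.Away planeElt S] :
    (∀ i, g i ≠ 0) ∧ UniqueFactorizationMonoid T := by
  have : IsDomain S := IsLocalization.Away.isDomain S planeElt_ne_zero
  obtain ⟨e, he, he0⟩ := exists_root z hz
  obtain ⟨P, p', hP⟩ := crt_exists x (y * z) hx (hxy.mul_right hxz)
  obtain ⟨Q, q', hQ⟩ := crt_exists z (x * y) hz (hxz.symm.mul_right hyz.symm)
  obtain ⟨i, j, k, hijk⟩ := bezout_three x y z hxy hxz hyz
  obtain ⟨σ, τ, μ, hσ, hτ, hμ⟩ := away_units (B := S) (X 0 : MvPolynomial (Fin 2) ℂ) (1 + X 0) (X 1)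
  have hτσ : (τ : S) = 1 + σ := by rw [hτ, hσ, map_add, map_one]
  obtain ⟨aS, haS⟩ : ∃ a : Sˣ, a = σ ^ P * τ ^ (y * q') * μ ^ (y * z) := ⟨_, rfl⟩
  obtain ⟨bS, hbS⟩ : ∃ b : Sˣ, b = σ ^ (z * p') * τ ^ (x * q') * μ ^ (x * z) := ⟨_, rfl⟩
  obtain ⟨cS, hcS⟩ : ∃ c : Sˣ, c = σ ^ (y * p') * τ ^ Q * μ ^ (x * y) := ⟨_, rfl⟩
  obtain ⟨r1, r2, r3⟩ := grp_from x y z P p' Q q' i j k hijk hP hQ aS bS cS σ τ μ haS hbS hcS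
  have r1' : (aS : S) ^ x = σ * (bS : S) ^ y := by exact_mod_cast congrArg Units.val r1
  have r2' : (cS : S) ^ z = τ * (bS : S) ^ y := by exact_mod_cast congrArg Units.val r2
  obtain ⟨f, hf⟩ := H.lift S ![(aS : S), bS, e • (cS : S)] (by
    simp only [Matrix.cons_val_zero, Matrix.cons_val_one, Matrix.cons_val]
    rw [smul_pow, he, neg_one_smul, r1', r2', hτσ]
    ring)
  have f0 : f (g 0) = aS := hf 0
  have f1 : f (g 1) = bS := hf 1
  have f2 : f (g 2) = e • (cS : S) := hf 2
  have f2u : IsUnit (f (g 2)) := by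
    rw [f2, Algebra.smul_def]
    exact ((IsUnit.mk0 e he0).map (algebraMap ℂ S)).mul cS.isUnit
  refine ⟨?_, ?_⟩
  · intro n hn
    have h0 : f (g n) = 0 := by rw [hn, map_zero]
    fin_cases n
    · exact aS.ne_zero (f0.symm.trans h0)
    · exact bS.ne_zero (f1.symm.trans h0)
    · exact f2u.ne_zero h0
  obtain ⟨Φ, hΦ⟩ := away_lift (B := T) (g 0 * g 1 * g 2) f (by
    rw [map_mul, map_mul, f0, f1]
    exact (aS.isUnit.mul bS.isUnit).mul f2u)
  obtain ⟨aT, bT, dT, haT, hbT, hdT⟩ := away_units (B := T) (g 0) (g 1) (g 2)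
  obtain ⟨cT, hcT⟩ : ∃ c : Tˣ, (c : T) = e⁻¹ • (dT : T) := by
    have : IsUnit (e⁻¹ • (dT : T)) := by
      rw [Algebra.smul_def]
      exact ((IsUnit.mk0 e⁻¹ (inv_ne_zero he0)).map (algebraMap ℂ T)).mul dT.isUnit
    exact ⟨this.unit, rfl⟩
  have relT : (aT : T) ^ x + (bT : T) ^ y = (cT : T) ^ z := by
    have := congrArg (algebraMap R T) H.rel
    simp only [map_add, map_pow, map_zero, ← haT, ← hbT, ← hdT] at this
    rw [hcT, smul_pow, inv_pow, he, inv_neg, inv_one, neg_one_smul]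
    linear_combination this
  obtain ⟨s, hs⟩ : ∃ s : Tˣ, s = aT ^ x / bT ^ y := ⟨_, rfl⟩
  obtain ⟨t, ht⟩ : ∃ t : Tˣ, t = cT ^ z / bT ^ y := ⟨_, rfl⟩
  obtain ⟨u, hu⟩ : ∃ u : Tˣ, u = (aT / (s ^ P * t ^ (y * q'))) ^ i *
      (bT / (s ^ (z * p') * t ^ (x * q'))) ^ j * (cT / (s ^ (y * p') * t ^ Q)) ^ k := ⟨_, rfl⟩
  obtain ⟨w1, w2, w3⟩ := grp_to x y z P p' Q q' i j k hijk hP hQ aT bT cT s t u hs ht hu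
  have hts : (t : T) = 1 + s := by
    have h1 : s * bT ^ y = aT ^ x := by rw [hs]; simp
    have h2 : t * bT ^ y = cT ^ z := by rw [ht]; simp
    have h1' : (s : T) * (bT : T) ^ y = (aT : T) ^ x := by exact_mod_cast congrArg Units.val h1
    have h2' : (t : T) * (bT : T) ^ y = (cT : T) ^ z := by exact_mod_cast congrArg Units.val h2
    apply (bT ^ y).isUnit.mul_right_cancel
    push_cast
    rw [h2', add_mul, h1', ← relT]
    ring
  obtain ⟨Ψ, hΨ⟩ := away_lift (B := S) planeElt (aeval ![(s : T), (u : T)]) (by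
    simp only [map_mul, map_add, map_one, aeval_X, Matrix.cons_val_zero, Matrix.cons_val_one]
    rw [← hts]
    exact (s.isUnit.mul t.isUnit).mul u.isUnit)
  -- images of the units
  have Ψσ : Units.map (Ψ : S →* T) σ = s := Units.ext (by
    change Ψ (σ : S) = s
    rw [hσ, hΨ]; simp)
  have Ψτ : Units.map (Ψ : S →* T) τ = t := Units.ext (by
    change Ψ (τ : S) = t
    rw [hτ, hΨ, hts]; simp)
  have Ψμ : Units.map (Ψ : S →* T) μ = u := Units.ext (by
    change Ψ (μ : S) = u
    rw [hμ, hΨ]; simp)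
  have Ψa : Units.map (Ψ : S →* T) aS = aT := by
    rw [haS, ← w1]; simp only [map_mul, map_pow, Ψσ, Ψτ, Ψμ]
  have Ψb : Units.map (Ψ : S →* T) bS = bT := by
    rw [hbS, ← w2]; simp only [map_mul, map_pow, Ψσ, Ψτ, Ψμ]
  have Ψc : Units.map (Ψ : S →* T) cS = cT := by
    rw [hcS, ← w3]; simp only [map_mul, map_pow, Ψσ, Ψτ, Ψμ]
  have Φa : Units.map (Φ : T →* S) aT = aS := Units.ext (by
    change Φ (aT : T) = aS
    rw [haT, hΦ, f0])
  have Φb : Units.map (Φ : T →* S) bT = bS := Units.ext (by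
    change Φ (bT : T) = bS
    rw [hbT, hΦ, f1])
  have Φc : Units.map (Φ : T →* S) cT = cS := Units.ext (by
    change Φ (cT : T) = cS
    rw [hcT, map_smul, hdT, hΦ, f2, smul_smul, inv_mul_cancel₀ he0, one_smul])
  have Φs : Units.map (Φ : T →* S) s = σ := by
    rw [hs, map_div, map_pow, map_pow, Φa, Φb, r1]; simp
  have Φt : Units.map (Φ : T →* S) t = τ := by
    rw [ht, map_div, map_pow, map_pow, Φc, Φb, r2]; simp
  have Φu : Units.map (Φ : T →* S) u = μ := by
    rw [hu]
    simp only [map_mul, map_zpow, map_div, map_pow, Φa, Φb, Φc, Φs, Φt]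
    exact r3
  have comp1 : Φ.comp Ψ = AlgHom.id ℂ S := by
    apply IsLocalization.algHom_ext (Submonoid.powers planeElt)
    apply MvPolynomial.algHom_ext
    intro n
    change Φ (Ψ (algebraMap _ S (X n))) = algebraMap _ S (X n)
    fin_cases n
    · have h1 : Ψ (σ : S) = s := congrArg Units.val Ψσ
      have h2 : Φ (s : T) = σ := congrArg Units.val Φs
      change Φ (Ψ (algebraMap _ S (X 0))) = algebraMap _ S (X 0)
      rw [← hσ, h1, h2]
    · have h1 : Ψ (μ : S) = u := congrArg Units.val Ψμ
      have h2 : Φ (u : T) = μ := congrArg Units.val Φu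
      change Φ (Ψ (algebraMap _ S (X 1))) = algebraMap _ S (X 1)
      rw [← hμ, h1, h2]
  have comp2 : Ψ.comp Φ = AlgHom.id ℂ T := by
    apply IsLocalization.algHom_ext (Submonoid.powers (g 0 * g 1 * g 2))
    apply AlgHom.ext_of_adjoin_eq_top H.gen
    have ka : Ψ (aS : S) = aT := congrArg Units.val Ψa
    have kb : Ψ (bS : S) = bT := congrArg Units.val Ψb
    have kc : Ψ (cS : S) = cT := congrArg Units.val Ψc
    rintro r (rfl | rfl | rfl)
    · change Ψ (Φ (algebraMap R T (g 0))) = algebraMap R T (g 0)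
      rw [hΦ, f0, ka, haT]
    · change Ψ (Φ (algebraMap R T (g 1))) = algebraMap R T (g 1)
      rw [hΦ, f1, kb, hbT]
    · change Ψ (Φ (algebraMap R T (g 2))) = algebraMap R T (g 2)
      rw [hΦ, f2, map_smul, kc, hcT, smul_smul, mul_inv_cancel₀ he0, one_smul, hdT]
  have hS : UniqueFactorizationMonoid S :=
    UniqueFactorizationMonoid.of_isLocalization (Submonoid.powers planeElt) S
  exact (AlgEquiv.ofAlgHom Φ Ψ comp1 comp2).symm.toMulEquiv.uniqueFactorizationMonoid hS

theorem surf_ufd {R : Type} [CommRing R] [IsDomain R] [IsNoetherianRing R] [Algebra ℂ R]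
    {g : Fin 3 → R} (x y z : ℕ) (hx : 0 < x) (hy : 0 < y) (hz : 0 < z)
    (hxy : Nat.Coprime x y) (hxz : Nat.Coprime x z) (hyz : Nat.Coprime y z)
    (H : IsSurf R x y z g) : UniqueFactorizationMonoid R := by
  obtain ⟨hne, hT⟩ := surf_main x y z hx hz hxy hxz hyz H
    (Localization.Away (g 0 * g 1 * g 2)) (Localization.Away planeElt)
  have hp := gen_prime x y z hx hy hz hxy hxz hyz H hne
  exact nagata_three (T := Localization.Away (g 0 * g 1 * g 2)) (g 0) (g 1) (g 2)
    (hp 0) (hp 1) (hp 2)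

/-- for pairwise coprime positive integers `x, y, z`, the coordinate ring
`ℂ[T₀,T₁,T₂]/⟨T₀^x + T₁^y + T₂^z⟩` of the Pham–Brieskorn surface is a unique
factorization domain (equivalently, the surface has trivial divisor class group). -/
theorem stmt_13 (x y z : ℕ) (hx : 0 < x) (hy : 0 < y) (hz : 0 < z)
    (hxy : Nat.Coprime x y) (hxz : Nat.Coprime x z) (hyz : Nat.Coprime y z)
    [IsDomain (MvPolynomial (Fin 3) ℂ ⧸
      Ideal.span {(X 0 : MvPolynomial (Fin 3) ℂ) ^ x + X 1 ^ y + X 2 ^ z})] :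
    UniqueFactorizationMonoid (MvPolynomial (Fin 3) ℂ ⧸
      Ideal.span {(X 0 : MvPolynomial (Fin 3) ℂ) ^ x + X 1 ^ y + X 2 ^ z}) := by
  exact surf_ufd x y z hx hy hz hxy hxz hyz (isSurf_quot _ x y z rfl)
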